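/- arXiv:1706.09728 — 2 statements merged into one kernel-verified Lean document; each statement's English description precedes it below -/
import Mathlib

section
/- Let X_1, …, X_n be independent real random variables with E[X_k] = 0 and E[|X_k|³] < ∞ for each k, and set Z_n := X_1 + ⋯ + X_n. Then d_W(Z_n, 𝒩) ≤ |1 − E[Z_n²]| + Σ_{k=1}^n E[|X_k|³] + Σ_{k=1}^n E[|X_k|] E[X_k²]. -/
open MeasureTheory ProbabilityTheory

/-- Wasserstein distance between two laws on `ℝ`, as a supremum over
1-Lipschitz test functions. -/
noncomputable def dW (μ ν : Measure ℝ) : ℝ :=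
  ⨆ h : {f : ℝ → ℝ // LipschitzWith 1 f}, |(∫ x, h.1 x ∂μ) - ∫ x, h.1 x ∂ν|

/-- The standard Gaussian law `N(0,1)` on `ℝ`. -/
noncomputable def stdGaussian : Measure ℝ := gaussianReal 0 1

namespace GaussianStein

open Filter Set Topology

/-- The standard Gaussian density. -/
noncomputable abbrev density : ℝ → ℝ := gaussianPDFReal 0 1

lemma density_eq (x : ℝ) :
    density x = (√(2 * Real.pi))⁻¹ * Real.exp (-(1 / 2) * x ^ 2) := by
  simp only [density, gaussianPDFReal, NNReal.coe_one, mul_one, sub_zero]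
  congr 2
  ring

lemma density_pos (x : ℝ) : 0 < density x := gaussianPDFReal_pos 0 1 x one_ne_zero

lemma density_le (x : ℝ) : density x ≤ 2 / 5 := by
  have hpi : (5 / 2 : ℝ) ≤ √(2 * Real.pi) := by
    apply Real.le_sqrt_of_sq_le
    nlinarith [Real.pi_gt_d2]
  have hexp : Real.exp (-(1 / 2) * x ^ 2) ≤ 1 := Real.exp_le_one_iff.2 (by nlinarith [sq_nonneg x])
  have hinv : (√(2 * Real.pi))⁻¹ ≤ 2 / 5 := by
    rw [inv_le_comm₀ (by linarith) (by norm_num)]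
    linarith
  rw [density_eq]
  calc _ ≤ (2 / 5 : ℝ) * 1 := by gcongr
    _ = 2 / 5 := by norm_num

lemma hasDerivAt_density (x : ℝ) : HasDerivAt density (-(x * density x)) x := by
  have h : HasDerivAt (fun y : ℝ ↦ (√(2 * Real.pi))⁻¹ * Real.exp (-(1 / 2) * y ^ 2))
      ((√(2 * Real.pi))⁻¹ * (Real.exp (-(1 / 2) * x ^ 2) * (-(1 / 2) * (2 * x)))) x := by
    have h := ((((hasDerivAt_id' x).pow 2).const_mul (-(1 / 2))).exp).const_mul
      ((√(2 * Real.pi))⁻¹)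
    rwa [show 2 - 1 = 1 from rfl, pow_one, mul_one, Nat.cast_ofNat] at h
  rw [funext density_eq]
  convert h using 1
  ring

lemma continuous_density : Continuous density :=
  continuous_iff_continuousAt.2 fun x ↦ (hasDerivAt_density x).continuousAt

lemma integrable_density : Integrable density := integrable_gaussianPDFReal 0 1

lemma integrable_pow_mul_density (k : ℕ) : Integrable fun t ↦ t ^ k * density t := by
  have h := (integrable_rpow_mul_exp_neg_mul_sq (b := 1 / 2) (by norm_num) (s := k)
    (by linarith [k.cast_nonneg (α := ℝ)])).const_mul (√(2 * Real.pi))⁻¹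
  refine h.congr (.of_forall fun t ↦ ?_)
  simp only [density_eq, Real.rpow_natCast]
  ring

lemma integrable_mul_density : Integrable fun t ↦ t * density t := by
  simpa using integrable_pow_mul_density 1

lemma tendsto_abs_pow_mul_density (k : ℕ) :
    Tendsto (fun t ↦ |t| ^ k * density t) (cocompact ℝ) (𝓝 0) := by
  have h := (tendsto_rpow_abs_mul_exp_neg_mul_sq_cocompact (a := 1 / 2) (by norm_num)
    k).const_mul (√(2 * Real.pi))⁻¹
  rw [mul_zero] at h
  refine h.congr fun t ↦ ?_
  simp only [density_eq, Real.rpow_natCast]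
  ring

lemma tendsto_density : Tendsto density (cocompact ℝ) (𝓝 0) := by
  simpa using tendsto_abs_pow_mul_density 0

lemma tendsto_mul_density : Tendsto (fun t ↦ t * density t) (cocompact ℝ) (𝓝 0) := by
  rw [tendsto_zero_iff_abs_tendsto_zero]
  refine (tendsto_abs_pow_mul_density 1).congr fun t ↦ ?_
  simp [abs_mul, abs_of_pos (density_pos t)]

/-- The lower Gaussian tail. -/
noncomputable def lowerTail (x : ℝ) : ℝ := ∫ t in Iic x, density t

/-- The upper Gaussian tail. -/
noncomputable def upperTail (x : ℝ) : ℝ := ∫ t in Ioi x, density t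

lemma lowerTail_add_upperTail (x : ℝ) : lowerTail x + upperTail x = 1 := by
  rw [lowerTail, upperTail, intervalIntegral.integral_Iic_add_Ioi
    integrable_density.integrableOn integrable_density.integrableOn]
  exact integral_gaussianPDFReal_eq_one 0 one_ne_zero

lemma lowerTail_nonneg (x : ℝ) : 0 ≤ lowerTail x :=
  integral_nonneg fun t ↦ (density_pos t).le

lemma upperTail_nonneg (x : ℝ) : 0 ≤ upperTail x :=
  integral_nonneg fun t ↦ (density_pos t).le

lemma integral_Ioi_mul_density (x : ℝ) : ∫ t in Ioi x, t * density t = density x := by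
  have h := integral_Ioi_of_hasDerivAt_of_tendsto' (a := x) (f := fun t ↦ -density t)
    (f' := fun t ↦ t * density t) (m := 0)
    (fun t _ ↦ (hasDerivAt_density t).fun_neg.congr_deriv (neg_neg _))
    integrable_mul_density.integrableOn
    (by simpa using (tendsto_density.mono_left atTop_le_cocompact).neg)
  simpa using h

lemma integral_Iic_mul_density (x : ℝ) : ∫ t in Iic x, t * density t = -density x := by
  have h := integral_Iic_of_hasDerivAt_of_tendsto' (a := x) (f := fun t ↦ -density t)
    (f' := fun t ↦ t * density t) (m := 0)
    (fun t _ ↦ (hasDerivAt_density t).fun_neg.congr_deriv (neg_neg _))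
    integrable_mul_density.integrableOn
    (by simpa using (tendsto_density.mono_left atBot_le_cocompact).neg)
  simpa using h

lemma hasDerivAt_neg_mul_density (t : ℝ) :
    HasDerivAt (fun t ↦ -(t * density t)) (t ^ 2 * density t - density t) t :=
  ((hasDerivAt_id' t).fun_mul (hasDerivAt_density t)).fun_neg.congr_deriv (by ring)

lemma integral_Ioi_sq_mul_density (x : ℝ) :
    ∫ t in Ioi x, t ^ 2 * density t = x * density x + upperTail x := by
  have h := integral_Ioi_of_hasDerivAt_of_tendsto' (a := x) (m := 0)
    (fun t _ ↦ hasDerivAt_neg_mul_density t)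
    ((integrable_pow_mul_density 2).sub integrable_density).integrableOn
    (by simpa using (tendsto_mul_density.mono_left atTop_le_cocompact).neg)
  rw [integral_sub (integrable_pow_mul_density 2).integrableOn
    integrable_density.integrableOn] at h
  rw [upperTail]
  linarith

lemma integral_Iic_sq_mul_density (x : ℝ) :
    ∫ t in Iic x, t ^ 2 * density t = lowerTail x - x * density x := by
  have h := integral_Iic_of_hasDerivAt_of_tendsto' (a := x) (m := 0)
    (fun t _ ↦ hasDerivAt_neg_mul_density t)
    ((integrable_pow_mul_density 2).sub integrable_density).integrableOn
    (by simpa using (tendsto_mul_density.mono_left atBot_le_cocompact).neg)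
  rw [integral_sub (integrable_pow_mul_density 2).integrableOn
    integrable_density.integrableOn] at h
  rw [lowerTail]
  linarith

lemma setIntegral_quadratic_mul_density (s : Set ℝ) (a : ℝ) :
    ∫ t in s, (t - a) ^ 2 * density t = (∫ t in s, t ^ 2 * density t)
      - 2 * a * (∫ t in s, t * density t) + a ^ 2 * ∫ t in s, density t := by
  have h1 := (integrable_pow_mul_density 2).integrableOn (s := s)
  have h2 := (integrable_mul_density.const_mul (2 * a)).integrableOn (s := s)
  have h3 := (integrable_density.const_mul (a ^ 2)).integrableOn (s := s)
  rw [← integral_const_mul, ← integral_const_mul, ← integral_sub h1 h2,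
    ← integral_add (by exact h1.sub h2) h3]
  congr 1 with t
  ring

lemma upperTail_quadratic_nonneg (x a : ℝ) :
    0 ≤ (1 + a ^ 2) * upperTail x + (x - 2 * a) * density x := by
  have h : 0 ≤ ∫ t in Ioi x, (t - a) ^ 2 * density t :=
    integral_nonneg fun t ↦ mul_nonneg (sq_nonneg _) (density_pos t).le
  rw [setIntegral_quadratic_mul_density, integral_Ioi_sq_mul_density,
    integral_Ioi_mul_density, ← upperTail] at h
  linarith

lemma lowerTail_quadratic_nonneg (x a : ℝ) :
    0 ≤ (1 + a ^ 2) * lowerTail x - (x - 2 * a) * density x := by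
  have h : 0 ≤ ∫ t in Iic x, (t - a) ^ 2 * density t :=
    integral_nonneg fun t ↦ mul_nonneg (sq_nonneg _) (density_pos t).le
  rw [setIntegral_quadratic_mul_density, integral_Iic_sq_mul_density,
    integral_Iic_mul_density, ← lowerTail] at h
  linarith

lemma lowerExcess_nonneg (x : ℝ) : 0 ≤ x * lowerTail x + density x := by
  have h : 0 ≤ ∫ t in Iic x, (x * density t - t * density t) :=
    setIntegral_nonneg measurableSet_Iic fun t ht ↦ by
      nlinarith [density_pos t, mem_Iic.1 ht]
  rwa [integral_sub (integrable_density.const_mul x).integrableOn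
    integrable_mul_density.integrableOn, integral_const_mul, integral_Iic_mul_density,
    ← lowerTail, sub_neg_eq_add] at h

lemma upperExcess_nonneg (x : ℝ) : 0 ≤ density x - x * upperTail x := by
  have h : 0 ≤ ∫ t in Ioi x, (t * density t - x * density t) :=
    setIntegral_nonneg measurableSet_Ioi fun t ht ↦ by
      nlinarith [density_pos t, mem_Ioi.1 ht]
  rwa [integral_sub integrable_mul_density.integrableOn
    (integrable_density.const_mul x).integrableOn, integral_const_mul, integral_Ioi_mul_density,
    ← upperTail] at h

/-- An upper bound on a product of Gaussian excesses, from the Cauchy–Schwarz bound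
`p ^ 2 ≤ q ^ 2 + x p q` on the tail `q` at `x ≥ 0` and the density `p` there. -/
lemma two_mul_excess_le {x p q : ℝ} (hx : 0 ≤ x) (hp : 0 < p) (hp' : p ≤ 2 / 5) (hq : 0 ≤ q)
    (hb : 0 ≤ p - x * q) (h : p ^ 2 ≤ q ^ 2 + x * p * q) :
    2 * (x * (1 - q) + p) * (p - x * q) ≤ p := by
  obtain ⟨m, rfl⟩ : ∃ m, q = m * p := ⟨q / p, by field_simp⟩
  have hm : 0 ≤ m := by
    by_contra! hm
    nlinarith
  obtain ⟨r, hr, hrb⟩ : ∃ r, 0 ≤ r ∧ r ^ 2 = 1 - x * m :=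
    ⟨√(1 - x * m), Real.sqrt_nonneg _, Real.sq_sqrt (by
      by_contra! hc
      nlinarith)⟩
  have hxm : 0 ≤ x * m := mul_nonneg hx hm
  have hr1 : r ≤ 1 := by nlinarith
  have hrm : r ≤ m := by
    have : p ^ 2 * (m ^ 2 + x * m - 1) ≥ 0 := by nlinarith
    have : 0 ≤ m ^ 2 + x * m - 1 := by
      by_contra! hc
      nlinarith [sq_pos_of_pos hp]
    exact (sq_le_sq₀ hr hm).1 (by linarith)
  have hxr : x * r ≤ 1 - r ^ 2 := by nlinarith
  have hpoly : 2 * r * (1 - r ^ 2) + 4 / 5 * r ^ 4 ≤ 1 := by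
    nlinarith [mul_nonneg (add_nonneg hr (by norm_num : (0 : ℝ) ≤ 1.49)) (sq_nonneg (r - 0.745)),
      mul_nonneg (pow_nonneg hr 3) (sub_nonneg.2 hr1)]
  have key : 2 * r ^ 2 * (x + p * r ^ 2) ≤ 1 := by
    have h1 : r * (x * r) ≤ r * (1 - r ^ 2) := by gcongr
    have h2 : p * r ^ 4 ≤ 2 / 5 * r ^ 4 := by gcongr
    nlinarith
  have e : 2 * (x * (1 - m * p) + p) * (p - x * (m * p)) = p * (2 * r ^ 2 * (x + p * r ^ 2)) := by
    rw [hrb]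
    ring
  rw [e]
  nlinarith

lemma two_mul_lowerExcess_mul_upperExcess_le (x : ℝ) :
    2 * (x * lowerTail x + density x) * (density x - x * upperTail x) ≤ density x := by
  have hsum := lowerTail_add_upperTail x
  have hp := density_pos x
  rcases le_total 0 x with hx | hx
  · have hq : 0 < upperTail x := by
      by_contra! hq
      have := le_antisymm hq (upperTail_nonneg x)
      have h := upperTail_quadratic_nonneg x (x + 1)
      rw [this] at h
      nlinarith
    have h := upperTail_quadratic_nonneg x (density x / upperTail x)
    have := two_mul_excess_le hx hp (density_le x) hq.le (upperExcess_nonneg x) (by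
      field_simp at h
      nlinarith)
    rwa [← eq_sub_of_add_eq hsum] at this
  · have hq : 0 < lowerTail x := by
      by_contra! hq
      have := le_antisymm hq (lowerTail_nonneg x)
      have h := lowerTail_quadratic_nonneg x (x - 1)
      rw [this] at h
      nlinarith
    have h := lowerTail_quadratic_nonneg x (-(density x / lowerTail x))
    have := two_mul_excess_le (neg_nonneg.2 hx) hp (density_le x) hq.le
      (by linarith [lowerExcess_nonneg x]) (by
      field_simp at h
      nlinarith)
    rw [← eq_sub_of_add_eq' hsum] at this
    linarith

lemma abs_sub_le_of_lipschitzWith_one {h : ℝ → ℝ} (hh : LipschitzWith 1 h) (x y : ℝ) :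
    |h x - h y| ≤ |x - y| := by
  simpa [Real.dist_eq] using hh.dist_le_mul x y

lemma integrable_lipschitz_mul_density {h : ℝ → ℝ} (hh : LipschitzWith 1 h) :
    Integrable fun t ↦ h t * density t := by
  have hdom : Integrable fun t ↦ |h 0| * density t + |t * density t| :=
    (integrable_density.const_mul _).add integrable_mul_density.abs
  refine hdom.mono' (hh.continuous.mul continuous_density).aestronglyMeasurable
    (.of_forall fun t ↦ ?_)
  have h1 := abs_sub_le_of_lipschitzWith_one hh t 0
  have h2 : |h t| ≤ |h 0| + |t| := by
    rw [sub_zero] at h1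
    linarith [abs_sub_abs_le_abs_sub (h t) (h 0)]
  rw [Real.norm_eq_abs, abs_mul, abs_mul, abs_of_pos (density_pos t), ← add_mul]
  exact mul_le_mul_of_nonneg_right h2 (density_pos t).le

lemma integral_gaussianReal_eq (h : ℝ → ℝ) : (∫ t, h t ∂gaussianReal 0 1) = ∫ t, h t * density t := by
  rw [integral_gaussianReal_eq_integral_smul one_ne_zero]
  simp only [smul_eq_mul, mul_comm]

/-- The Gaussian average of `h x - h t` over `t ≤ x`. -/
noncomputable def lowerOsc (h : ℝ → ℝ) (x : ℝ) : ℝ := ∫ t in Iic x, (h x - h t) * density t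

/-- The Gaussian average of `h t - h x` over `t > x`. -/
noncomputable def upperOsc (h : ℝ → ℝ) (x : ℝ) : ℝ := ∫ t in Ioi x, (h t - h x) * density t

lemma setIntegral_const_sub_mul_density {h : ℝ → ℝ} (hh : LipschitzWith 1 h) (s : Set ℝ) (a : ℝ) :
    ∫ t in s, (a - h t) * density t = a * (∫ t in s, density t) - ∫ t in s, h t * density t := by
  rw [← integral_const_mul, ← integral_sub (integrable_density.const_mul a).integrableOn
    (integrable_lipschitz_mul_density hh).integrableOn]
  simp only [sub_mul]

lemma setIntegral_sub_const_mul_density {h : ℝ → ℝ} (hh : LipschitzWith 1 h) (s : Set ℝ) (a : ℝ) :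
    ∫ t in s, (h t - a) * density t = (∫ t in s, h t * density t) - a * ∫ t in s, density t := by
  rw [← integral_const_mul, ← integral_sub (integrable_lipschitz_mul_density hh).integrableOn
    (integrable_density.const_mul a).integrableOn]
  simp only [sub_mul]

lemma abs_lowerOsc_le {h : ℝ → ℝ} (hh : LipschitzWith 1 h) (x : ℝ) :
    |lowerOsc h x| ≤ x * lowerTail x + density x := by
  have hid := setIntegral_const_sub_mul_density LipschitzWith.id (Iic x) x
  simp only [id] at hid
  rw [integral_Iic_mul_density, ← lowerTail, sub_neg_eq_add] at hid
  rw [← hid, lowerOsc, ← Real.norm_eq_abs]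
  refine norm_integral_le_of_norm_le ?_ ((ae_restrict_mem (measurableSet_Iic (a := x))).mono fun t ht ↦ ?_)
  · simp only [sub_mul]
    exact ((integrable_density.const_mul x).sub integrable_mul_density).integrableOn
  · rw [norm_mul, Real.norm_eq_abs, Real.norm_eq_abs, abs_of_pos (density_pos t)]
    gcongr
    · exact (density_pos t).le
    · exact (abs_sub_le_of_lipschitzWith_one hh x t).trans_eq (abs_of_nonneg (sub_nonneg.2 ht))

lemma abs_upperOsc_le {h : ℝ → ℝ} (hh : LipschitzWith 1 h) (x : ℝ) :
    |upperOsc h x| ≤ density x - x * upperTail x := by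
  have hid := setIntegral_sub_const_mul_density LipschitzWith.id (Ioi x) x
  simp only [id] at hid
  rw [integral_Ioi_mul_density, ← upperTail] at hid
  rw [← hid, upperOsc, ← Real.norm_eq_abs]
  refine norm_integral_le_of_norm_le ?_ ((ae_restrict_mem (measurableSet_Ioi (a := x))).mono fun t ht ↦ ?_)
  · simp only [sub_mul]
    exact (integrable_mul_density.sub (integrable_density.const_mul x)).integrableOn
  · rw [norm_mul, Real.norm_eq_abs, Real.norm_eq_abs, abs_of_pos (density_pos t)]
    gcongr
    · exact (density_pos t).le
    · exact (abs_sub_le_of_lipschitzWith_one hh t x).trans_eq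
        (abs_of_nonneg (sub_nonneg.2 (le_of_lt ht)))

lemma sub_integral_eq_osc {h : ℝ → ℝ} (hh : LipschitzWith 1 h) (x : ℝ) :
    h x - (∫ t, h t ∂gaussianReal 0 1) = lowerOsc h x - upperOsc h x := by
  have hi := integrable_lipschitz_mul_density hh
  rw [integral_gaussianReal_eq, lowerOsc, upperOsc, setIntegral_const_sub_mul_density hh,
    setIntegral_sub_const_mul_density hh, ← lowerTail, ← upperTail,
    ← intervalIntegral.integral_Iic_add_Ioi (b := x) hi.integrableOn hi.integrableOn]
  linear_combination (-h x) * lowerTail_add_upperTail x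

/-- The bounded solution of the Stein equation `f' x - x f x = h x - 𝔼 h(N)`. -/
noncomputable def steinSolution (h : ℝ → ℝ) (x : ℝ) : ℝ :=
  (∫ t in Iic x, (h t - ∫ s, h s ∂gaussianReal 0 1) * density t) / density x

lemma steinSolution_eq {h : ℝ → ℝ} (hh : LipschitzWith 1 h) (x : ℝ) :
    steinSolution h x =
      -(upperTail x * lowerOsc h x + lowerTail x * upperOsc h x) / density x := by
  have hlow : lowerOsc h x = h x * lowerTail x - ∫ t in Iic x, h t * density t :=
    setIntegral_const_sub_mul_density hh _ _
  rw [steinSolution, setIntegral_sub_const_mul_density hh, ← lowerTail]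
  congr 1
  linear_combination hlow + lowerTail x * sub_integral_eq_osc hh x
    + lowerOsc h x * lowerTail_add_upperTail x

/-- The derivative of `steinSolution h`, as given by the Stein equation. -/
noncomputable def steinDeriv (h : ℝ → ℝ) (x : ℝ) : ℝ :=
  x * steinSolution h x + (h x - ∫ s, h s ∂gaussianReal 0 1)

lemma hasDerivAt_steinSolution {h : ℝ → ℝ} (hh : LipschitzWith 1 h) (x : ℝ) :
    HasDerivAt (steinSolution h) (steinDeriv h x) x := by
  set c := ∫ s, h s ∂gaussianReal 0 1 with hc
  have hi : Integrable fun t ↦ (h t - c) * density t := by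
    simp only [sub_mul]
    exact (integrable_lipschitz_mul_density hh).sub (integrable_density.const_mul c)
  have hcont : Continuous fun t ↦ (h t - c) * density t :=
    (hh.continuous.sub continuous_const).mul continuous_density
  have hF : HasDerivAt (fun y ↦ ∫ t in Iic y, (h t - c) * density t) ((h x - c) * density x) x := by
    have h0 := (intervalIntegral.integral_hasDerivAt_right
      (hcont.intervalIntegrable 0 x) hcont.aestronglyMeasurable.stronglyMeasurableAtFilter
      hcont.continuousAt).const_add (∫ t in Iic 0, (h t - c) * density t)
    refine h0.congr_of_eventuallyEq (.of_forall fun y ↦ ?_)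
    simp only
    rw [← intervalIntegral.integral_Iic_sub_Iic hi.integrableOn hi.integrableOn]
    ring
  have hp := (density_pos x).ne'
  refine (hF.fun_div (hasDerivAt_density x) hp).congr_deriv ?_
  rw [steinDeriv, steinSolution, ← hc]
  field_simp
  ring

lemma abs_steinDeriv_le {h : ℝ → ℝ} (hh : LipschitzWith 1 h) (x : ℝ) : |steinDeriv h x| ≤ 1 := by
  have hp := density_pos x
  have ha := lowerExcess_nonneg x
  have hb := upperExcess_nonneg x
  have e : steinDeriv h x = (lowerOsc h x * (density x - x * upperTail x)
      - upperOsc h x * (x * lowerTail x + density x)) / density x := by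
    rw [steinDeriv, sub_integral_eq_osc hh, steinSolution_eq hh]
    field_simp
    ring
  rw [e, abs_div, abs_of_pos hp, div_le_one hp]
  calc _ ≤ |lowerOsc h x| * (density x - x * upperTail x)
        + |upperOsc h x| * (x * lowerTail x + density x) := by
        rw [← abs_of_nonneg ha, ← abs_of_nonneg hb, ← abs_mul, ← abs_mul,
          abs_of_nonneg ha, abs_of_nonneg hb]
        exact abs_sub _ _
    _ ≤ (x * lowerTail x + density x) * (density x - x * upperTail x)
        + (density x - x * upperTail x) * (x * lowerTail x + density x) := by
        gcongr
        · exact abs_lowerOsc_le hh x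
        · exact abs_upperOsc_le hh x
    _ ≤ density x := by linarith [two_mul_lowerExcess_mul_upperExcess_le x]

lemma abs_steinSolution_add_mul_steinDeriv_le {h : ℝ → ℝ} (hh : LipschitzWith 1 h) (x : ℝ) :
    |steinSolution h x + x * steinDeriv h x| ≤ 1 := by
  have hp := density_pos x
  have hu : 0 ≤ (1 + x ^ 2) * upperTail x - x * density x := by
    linarith [upperTail_quadratic_nonneg x x]
  have hl : 0 ≤ (1 + x ^ 2) * lowerTail x + x * density x := by
    linarith [lowerTail_quadratic_nonneg x x]
  have e : steinSolution h x + x * steinDeriv h x =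
      -(lowerOsc h x * ((1 + x ^ 2) * upperTail x - x * density x)
        + upperOsc h x * ((1 + x ^ 2) * lowerTail x + x * density x)) / density x := by
    rw [steinDeriv, sub_integral_eq_osc hh, steinSolution_eq hh]
    field_simp
    ring
  rw [e, abs_div, abs_of_pos hp, div_le_one hp, abs_neg]
  calc _ ≤ |lowerOsc h x| * ((1 + x ^ 2) * upperTail x - x * density x)
        + |upperOsc h x| * ((1 + x ^ 2) * lowerTail x + x * density x) := by
        rw [← abs_of_nonneg hu, ← abs_of_nonneg hl, ← abs_mul, ← abs_mul,
          abs_of_nonneg hu, abs_of_nonneg hl]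
        exact abs_add_le _ _
    _ ≤ (x * lowerTail x + density x) * ((1 + x ^ 2) * upperTail x - x * density x)
        + (density x - x * upperTail x) * ((1 + x ^ 2) * lowerTail x + x * density x) := by
        gcongr
        · exact abs_lowerOsc_le hh x
        · exact abs_upperOsc_le hh x
    _ = density x := by
        linear_combination density x * lowerTail_add_upperTail x

lemma abs_steinDeriv_sub_le {h : ℝ → ℝ} (hh : LipschitzWith 1 h) (x y : ℝ) :
    |steinDeriv h x - steinDeriv h y| ≤ 2 * |x - y| := by
  have hd (z : ℝ) : HasDerivAt (fun z ↦ z * steinSolution h z)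
      (steinSolution h z + z * steinDeriv h z) z := by
    simpa using (hasDerivAt_id' z).fun_mul (hasDerivAt_steinSolution hh z)
  have h1 : |x * steinSolution h x - y * steinSolution h y| ≤ 1 * |x - y| :=
    convex_univ.norm_image_sub_le_of_norm_hasDerivWithin_le
      (fun z _ ↦ (hd z).hasDerivWithinAt)
      (fun z _ ↦ abs_steinSolution_add_mul_steinDeriv_le hh z) (mem_univ y) (mem_univ x)
  have h2 := abs_sub_le_of_lipschitzWith_one hh x y
  calc |steinDeriv h x - steinDeriv h y|
      = |(x * steinSolution h x - y * steinSolution h y) + (h x - h y)| := by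
        rw [steinDeriv, steinDeriv]
        congr 1
        ring
    _ ≤ _ := (abs_add_le _ _).trans (by linarith)

/-- Regularity of the solutions of the Stein equation with `1`-Lipschitz data: `f` has derivative
`g`, which is bounded by `1` and `2`-Lipschitz. -/
structure IsSteinRegular (f g : ℝ → ℝ) : Prop where
  hasDerivAt (x : ℝ) : HasDerivAt f (g x) x
  abs_deriv_le (x : ℝ) : |g x| ≤ 1
  abs_deriv_sub_le (x y : ℝ) : |g x - g y| ≤ 2 * |x - y|

namespace IsSteinRegular

variable {f g : ℝ → ℝ}

lemma comp_add_const (hfg : IsSteinRegular f g) (v : ℝ) :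
    IsSteinRegular (fun x ↦ f (x + v)) fun x ↦ g (x + v) where
  hasDerivAt x := (hfg.hasDerivAt (x + v)).comp_add_const x v
  abs_deriv_le x := hfg.abs_deriv_le _
  abs_deriv_sub_le x y := by simpa using hfg.abs_deriv_sub_le (x + v) (y + v)

lemma continuous (hfg : IsSteinRegular f g) : Continuous f :=
  continuous_iff_continuousAt.2 fun x ↦ (hfg.hasDerivAt x).continuousAt

lemma continuous_deriv (hfg : IsSteinRegular f g) : Continuous g := by
  refine (LipschitzWith.of_dist_le_mul (K := 2) fun x y ↦ ?_).continuous
  simpa [Real.dist_eq] using hfg.abs_deriv_sub_le x y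

lemma abs_le (hfg : IsSteinRegular f g) (x : ℝ) : |f x| ≤ |f 0| + |x| := by
  have h : |f x - f 0| ≤ 1 * |x - 0| :=
    convex_univ.norm_image_sub_le_of_norm_hasDerivWithin_le
      (fun z _ ↦ (hfg.hasDerivAt z).hasDerivWithinAt)
      (fun z _ ↦ hfg.abs_deriv_le z) (Set.mem_univ 0) (Set.mem_univ x)
  rw [one_mul, sub_zero] at h
  linarith [abs_sub_abs_le_abs_sub (f x) (f 0)]

lemma abs_taylor_remainder_le (hfg : IsSteinRegular f g) (a h : ℝ) :
    |f (a + h) - f a - h * g a| ≤ h ^ 2 := by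
  have hd (t : ℝ) : HasDerivAt (fun t ↦ f (a + t * h) - f a - t * h * g a)
      (h * (g (a + t * h) - g a)) t := by
    have hl : HasDerivAt (fun t : ℝ ↦ a + t * h) h t := by
      simpa using ((hasDerivAt_id' t).mul_const h).const_add a
    have hl' : HasDerivAt (fun t : ℝ ↦ t * h * g a) (h * g a) t := by
      simpa using ((hasDerivAt_id' t).mul_const h).mul_const (g a)
    refine (((hfg.hasDerivAt (a + t * h)).comp t hl).sub_const (f a) |>.sub hl').congr_deriv ?_
    ring
  have hB (t : ℝ) : HasDerivAt (fun t ↦ h ^ 2 * t ^ 2) (h ^ 2 * (2 * t)) t := by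
    simpa using (hasDerivAt_pow 2 t).const_mul (h ^ 2)
  have key := image_norm_le_of_norm_deriv_right_le_deriv_boundary (a := 0) (b := 1)
    (fun t _ ↦ (hd t).continuousAt.continuousWithinAt) (fun t _ ↦ (hd t).hasDerivWithinAt)
    (by simp) hB (fun t ht ↦ ?_) (Set.right_mem_Icc.2 zero_le_one)
  · simpa using key
  · have h1 := hfg.abs_deriv_sub_le (a + t * h) a
    rw [add_sub_cancel_left, abs_mul, abs_of_nonneg ht.1] at h1
    rw [norm_mul, Real.norm_eq_abs, Real.norm_eq_abs]
    calc |h| * |g (a + t * h) - g a| ≤ |h| * (2 * (t * |h|)) := by gcongr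
      _ = h ^ 2 * (2 * t) := by rw [← sq_abs]; ring

lemma abs_exchange_le (hfg : IsSteinRegular f g) (x y : ℝ) :
    |f x - f y + y * g x - x * g y| ≤ x ^ 2 + y ^ 2 := by
  have hx := hfg.abs_taylor_remainder_le y x
  have hy := hfg.abs_taylor_remainder_le x y
  rw [add_comm y x] at hx
  calc |f x - f y + y * g x - x * g y|
      = |(f (x + y) - f y - x * g y) - (f (x + y) - f x - y * g x)| := by
        congr 1
        ring
    _ ≤ x ^ 2 + y ^ 2 := (abs_sub _ _).trans (add_le_add hx hy)

end IsSteinRegular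

lemma isSteinRegular_steinSolution {h : ℝ → ℝ} (hh : LipschitzWith 1 h) :
    IsSteinRegular (steinSolution h) (steinDeriv h) where
  hasDerivAt := hasDerivAt_steinSolution hh
  abs_deriv_le := abs_steinDeriv_le hh
  abs_deriv_sub_le := abs_steinDeriv_sub_le hh

lemma integrable_sq_of_integrable_abs_pow_three {Ω : Type*} [MeasurableSpace Ω] {P : Measure Ω}
    {X : Ω → ℝ} (h1 : Integrable X P) (h3 : Integrable (fun ω ↦ |X ω| ^ 3) P) :
    Integrable (fun ω ↦ X ω ^ 2) P := by
  refine (h1.abs.add h3).mono' (h1.aestronglyMeasurable.pow 2) (.of_forall fun ω ↦ ?_)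
  rw [Real.norm_eq_abs, abs_pow, Pi.add_apply]
  nlinarith [abs_nonneg (X ω), mul_nonneg (abs_nonneg (X ω)) (sq_nonneg (|X ω| - 1))]

section Moments

variable {Ω : Type*} [MeasurableSpace Ω] {P : Measure Ω} {X V : Ω → ℝ}
  {f g : ℝ → ℝ}

lemma IsSteinRegular.integrable_comp [IsProbabilityMeasure P] (hfg : IsSteinRegular f g) (hV : Integrable V P) :
    Integrable (fun ω ↦ f (V ω)) P := by
  refine ((integrable_const |f 0|).add hV.abs).mono'
    (hfg.continuous.comp_aestronglyMeasurable hV.aestronglyMeasurable) (.of_forall fun ω ↦ ?_)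
  exact hfg.abs_le _

lemma IsSteinRegular.integrable_deriv_comp [IsProbabilityMeasure P] (hfg : IsSteinRegular f g)
    (hV : AEStronglyMeasurable V P) : Integrable (fun ω ↦ g (V ω)) P :=
  .of_bound (hfg.continuous_deriv.comp_aestronglyMeasurable hV) 1
    (.of_forall fun _ ↦ hfg.abs_deriv_le _)

lemma IsSteinRegular.integrable_mul_comp (hfg : IsSteinRegular f g) (hX : Integrable X P)
    (hX2 : Integrable (fun ω ↦ X ω ^ 2) P) (hV : Integrable V P)
    (hV2 : Integrable (fun ω ↦ V ω ^ 2) P) :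
    Integrable (fun ω ↦ X ω * f (V ω)) P := by
  refine ((hX.abs.const_mul |f 0|).add (hX2.add hV2)).mono' (hX.aestronglyMeasurable.mul
    (hfg.continuous.comp_aestronglyMeasurable hV.aestronglyMeasurable)) (.of_forall fun ω ↦ ?_)
  have h := mul_le_mul_of_nonneg_left (hfg.abs_le (V ω)) (abs_nonneg (X ω))
  rw [Real.norm_eq_abs, abs_mul]
  simp only [Pi.add_apply]
  rw [← sq_abs (X ω), ← sq_abs (V ω)]
  nlinarith [sq_nonneg (|X ω| - |V ω|), sq_nonneg |X ω|, sq_nonneg |V ω|]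

/-- The Stein identity for a centered variable, up to third-moment errors. The proof compares `X`
with an independent copy. -/
lemma IsSteinRegular.abs_integral_mul_sub_le [IsProbabilityMeasure P] (hfg : IsSteinRegular f g) (hX : Integrable X P)
    (hX0 : ∫ ω, X ω ∂P = 0) (hX3 : Integrable (fun ω ↦ |X ω| ^ 3) P) :
    |(∫ ω, X ω * f (X ω) ∂P) - (∫ ω, X ω ^ 2 ∂P) * ∫ ω, g (X ω) ∂P| ≤
      (∫ ω, |X ω| ^ 3 ∂P) + (∫ ω, |X ω| ∂P) * ∫ ω, X ω ^ 2 ∂P := by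
  have hX2 := integrable_sq_of_integrable_abs_pow_three hX hX3
  have hf := hfg.integrable_comp hX
  have hg := hfg.integrable_deriv_comp hX.aestronglyMeasurable
  have hXf := hfg.integrable_mul_comp hX hX2 hX hX2
  have hXg : Integrable (fun ω ↦ X ω * g (X ω)) P :=
    hX.mul_bdd (c := 1) hg.aestronglyMeasurable (.of_forall fun _ ↦ hfg.abs_deriv_le _)
  have hone : Integrable (fun _ : Ω ↦ (1 : ℝ)) P := integrable_const 1
  have i1 := hXf.mul_prod hone
  have i2 := hX.mul_prod hf
  have i3 := hXg.mul_prod hX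
  have i4 := hX2.mul_prod hg
  have e : (∫ ω, X ω * f (X ω) ∂P) - (∫ ω, X ω ^ 2 ∂P) * ∫ ω, g (X ω) ∂P =
      ∫ z, X z.1 * (f (X z.1) - f (X z.2) + X z.2 * g (X z.1) - X z.1 * g (X z.2)) ∂P.prod P := by
    calc _ = (∫ z, X z.1 * f (X z.1) * 1 ∂P.prod P) - (∫ z, X z.1 * f (X z.2) ∂P.prod P)
          + (∫ z, X z.1 * g (X z.1) * X z.2 ∂P.prod P)
          - ∫ z, X z.1 ^ 2 * g (X z.2) ∂P.prod P := by
          rw [integral_prod_mul (fun ω ↦ X ω * f (X ω)) fun _ ↦ (1 : ℝ),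
            integral_prod_mul X fun ω ↦ f (X ω), integral_prod_mul (fun ω ↦ X ω * g (X ω)) X,
            integral_prod_mul (fun ω ↦ X ω ^ 2) fun ω ↦ g (X ω), hX0]
          simp
      _ = _ := by
          rw [← integral_sub i1 i2, ← integral_add (by exact i1.sub i2) i3,
            ← integral_sub (by exact (i1.sub i2).add i3) i4]
          congr 1 with z
          ring
  have j1 := hX3.mul_prod hone
  have j2 := hX.abs.mul_prod hX2
  calc _ ≤ ∫ z, |X z.1| ^ 3 * 1 + |X z.1| * X z.2 ^ 2 ∂P.prod P := by
        rw [e, ← Real.norm_eq_abs]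
        refine norm_integral_le_of_norm_le (by exact j1.add j2) (.of_forall fun z ↦ ?_)
        rw [norm_mul, Real.norm_eq_abs, Real.norm_eq_abs]
        have := mul_le_mul_of_nonneg_left (hfg.abs_exchange_le (X z.1) (X z.2))
          (abs_nonneg (X z.1))
        rw [← sq_abs (X z.1)] at this
        linarith
    _ = _ := by
        rw [integral_add j1 j2, integral_prod_mul (fun ω ↦ |X ω| ^ 3) fun _ ↦ (1 : ℝ),
          integral_prod_mul (fun ω ↦ |X ω|) fun ω ↦ X ω ^ 2]
        simp

lemma IsSteinRegular.abs_integral_mul_comp_add_sub_le [IsProbabilityMeasure P] (hfg : IsSteinRegular f g)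
    (hXm : Measurable X) (hVm : Measurable V) (hXV : IndepFun X V P)
    (hX : Integrable X P) (hX0 : ∫ ω, X ω ∂P = 0) (hX3 : Integrable (fun ω ↦ |X ω| ^ 3) P)
    (hV : Integrable V P) (hV2 : Integrable (fun ω ↦ V ω ^ 2) P) :
    |(∫ ω, X ω * f (X ω + V ω) ∂P) - (∫ ω, X ω ^ 2 ∂P) * ∫ ω, g (X ω + V ω) ∂P| ≤
      (∫ ω, |X ω| ^ 3 ∂P) + (∫ ω, |X ω| ∂P) * ∫ ω, X ω ^ 2 ∂P := by
  have hX2 := integrable_sq_of_integrable_abs_pow_three hX hX3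
  have hS := hX.add hV
  have hS2 : Integrable (fun ω ↦ (X ω + V ω) ^ 2) P := by
    refine ((hX2.add hV2).const_mul 2).mono' (hS.aestronglyMeasurable.pow 2)
      (.of_forall fun ω ↦ ?_)
    rw [Real.norm_eq_abs, abs_of_nonneg (sq_nonneg _), Pi.add_apply]
    exact add_sq_le
  set s := ∫ ω, X ω ^ 2 ∂P with hs
  have hmap := (indepFun_iff_map_prod_eq_prod_map_map hXm.aemeasurable hVm.aemeasurable).1 hXV
  have hcont : Continuous fun z : ℝ × ℝ ↦ z.1 * f (z.1 + z.2) - s * g (z.1 + z.2) := by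
    have := hfg.continuous
    have := hfg.continuous_deriv
    fun_prop
  have hi1 := hfg.integrable_mul_comp hX hX2 hS hS2
  have hi2 := (hfg.integrable_deriv_comp hS.aestronglyMeasurable).const_mul s
  have hint : Integrable (fun z : ℝ × ℝ ↦ z.1 * f (z.1 + z.2) - s * g (z.1 + z.2))
      ((P.map X).prod (P.map V)) := by
    rw [← hmap, integrable_map_measure hcont.aestronglyMeasurable
      (hXm.prodMk hVm).aemeasurable]
    exact hi1.sub hi2
  have : IsProbabilityMeasure (P.map V) := Measure.isProbabilityMeasure_map hVm.aemeasurable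
  have : IsProbabilityMeasure (P.map X) := Measure.isProbabilityMeasure_map hXm.aemeasurable
  have e : (∫ ω, X ω * f (X ω + V ω) ∂P) - s * ∫ ω, g (X ω + V ω) ∂P =
      ∫ v, ((∫ ω, X ω * f (X ω + v) ∂P) - s * ∫ ω, g (X ω + v) ∂P) ∂P.map V := by
    calc _ = ∫ z, (z.1 * f (z.1 + z.2) - s * g (z.1 + z.2)) ∂P.map fun ω ↦ (X ω, V ω) := by
          rw [integral_map (hXm.prodMk hVm).aemeasurable hcont.aestronglyMeasurable,
            ← integral_const_mul]
          exact (integral_sub hi1 hi2).symm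
      _ = _ := by
          rw [hmap, integral_prod_symm _ hint]
          congr 1 with v
          have hv := hfg.comp_add_const v
          rw [integral_map hXm.aemeasurable (by exact (hcont.comp
            (by fun_prop : Continuous fun x : ℝ ↦ (x, v))).aestronglyMeasurable), ← integral_const_mul]
          exact integral_sub (hv.integrable_mul_comp hX hX2 hX hX2)
            ((hv.integrable_deriv_comp hX.aestronglyMeasurable).const_mul s)
  rw [e, ← Real.norm_eq_abs]
  refine (norm_integral_le_of_norm_le_const (.of_forall fun v ↦
    (hfg.comp_add_const v).abs_integral_mul_sub_le hX hX0 hX3)).trans_eq ?_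
  simp [hs]

end Moments

section Sum

variable {Ω : Type*} [MeasurableSpace Ω] {P : Measure Ω} [IsProbabilityMeasure P]
  {n : ℕ} {X : Fin n → Ω → ℝ}

lemma integral_sum_sq (hmeas : ∀ k, Measurable (X k)) (hindep : iIndepFun X P)
    (hX0 : ∀ k, ∫ ω, X k ω ∂P = 0) (hX2 : ∀ k, Integrable (fun ω ↦ X k ω ^ 2) P) :
    ∫ ω, (∑ k, X k ω) ^ 2 ∂P = ∑ k, ∫ ω, X k ω ^ 2 ∂P := by
  have hL (k : Fin n) : MemLp (X k) 2 P :=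
    (memLp_two_iff_integrable_sq (hmeas k).aestronglyMeasurable).2 (hX2 k)
  have h := IndepFun.variance_sum (s := Finset.univ) (fun k _ ↦ hL k)
    fun i _ j _ hij ↦ hindep.indepFun hij
  rw [variance_of_integral_eq_zero (by fun_prop)] at h
  · simpa [Finset.sum_apply, variance_of_integral_eq_zero (hmeas _).aemeasurable (hX0 _)] using h
  · simp only [Finset.sum_apply]
    rw [integral_finsetSum _ fun k _ ↦ (hL k).integrable one_le_two]
    simp [hX0]

lemma abs_integral_comp_sum_sub_le {h : ℝ → ℝ} (hh : LipschitzWith 1 h)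
    (hmeas : ∀ k, Measurable (X k)) (hindep : iIndepFun X P)
    (hX : ∀ k, Integrable (X k) P) (hX0 : ∀ k, ∫ ω, X k ω ∂P = 0)
    (hX3 : ∀ k, Integrable (fun ω ↦ |X k ω| ^ 3) P) :
    |(∫ ω, h (∑ k, X k ω) ∂P) - ∫ x, h x ∂gaussianReal 0 1| ≤
      |1 - ∫ ω, (∑ k, X k ω) ^ 2 ∂P| + (∑ k, ∫ ω, |X k ω| ^ 3 ∂P) +
        ∑ k, (∫ ω, |X k ω| ∂P) * ∫ ω, X k ω ^ 2 ∂P := by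
  have hX2 k := integrable_sq_of_integrable_abs_pow_three (hX k) (hX3 k)
  have hL (s : Finset (Fin n)) : MemLp (fun ω ↦ ∑ k ∈ s, X k ω) 2 P :=
    memLp_finsetSum s fun k _ ↦
      (memLp_two_iff_integrable_sq (hmeas k).aestronglyMeasurable).2 (hX2 k)
  have hS (s : Finset (Fin n)) := (hL s).integrable one_le_two
  have hS2 (s : Finset (Fin n)) := (hL s).integrable_sq
  have hfg := isSteinRegular_steinSolution hh
  set f := steinSolution h with hf
  set g := steinDeriv h with hg
  have hgi := hfg.integrable_deriv_comp (hS Finset.univ).aestronglyMeasurable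
  have hXf k := hfg.integrable_mul_comp (hX k) (hX2 k) (hS Finset.univ) (hS2 Finset.univ)
  have hWf : Integrable (fun ω ↦ ∑ k, X k ω * f (∑ j, X j ω)) P :=
    integrable_finsetSum _ fun k _ ↦ hXf k
  have hpoint (x : ℝ) : h x = (∫ x, h x ∂gaussianReal 0 1) + (g x - x * f x) := by
    rw [hg, hf, steinDeriv]
    ring
  have hstein : (∫ ω, h (∑ k, X k ω) ∂P) - ∫ x, h x ∂gaussianReal 0 1 =
      (∫ ω, g (∑ k, X k ω) ∂P) - ∑ k, ∫ ω, X k ω * f (∑ j, X j ω) ∂P := by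
    rw [← integral_finsetSum _ fun k _ ↦ hXf k, ← integral_sub hgi hWf, sub_eq_iff_eq_add']
    calc _ = ∫ ω, ((∫ x, h x ∂gaussianReal 0 1) +
          (g (∑ k, X k ω) - ∑ k, X k ω * f (∑ j, X j ω))) ∂P := by
          congr 1 with ω
          rw [hpoint, Finset.sum_mul]
      _ = _ := by
          rw [integral_add (integrable_const _) (by exact hgi.sub hWf)]
          simp
  have hterm (k : Fin n) : |(∫ ω, X k ω * f (∑ j, X j ω) ∂P)
      - (∫ ω, X k ω ^ 2 ∂P) * ∫ ω, g (∑ j, X j ω) ∂P| ≤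
      (∫ ω, |X k ω| ^ 3 ∂P) + (∫ ω, |X k ω| ∂P) * ∫ ω, X k ω ^ 2 ∂P := by
    have hsum (ω : Ω) : ∑ j, X j ω = X k ω + ∑ j ∈ Finset.univ.erase k, X j ω :=
      (Finset.add_sum_erase _ _ (Finset.mem_univ k)).symm
    have hi : IndepFun (X k) (fun ω ↦ ∑ j ∈ Finset.univ.erase k, X j ω) P := by
      have := hindep.indepFun_finsetSum_of_notMem hmeas (Finset.notMem_erase k Finset.univ)
      simpa only [Finset.sum_fn] using this.symm
    simp only [hsum]
    exact hfg.abs_integral_mul_comp_add_sub_le (hmeas k) (by fun_prop) hi (hX k) (hX0 k) (hX3 k)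
      (hS _) (hS2 _)
  have hg1 : |∫ ω, g (∑ k, X k ω) ∂P| ≤ 1 := by
    have := norm_integral_le_of_norm_le_const (μ := P) (f := fun ω ↦ g (∑ k, X k ω)) (C := 1)
      (.of_forall fun _ ↦ hfg.abs_deriv_le _)
    simpa using this
  have hdecomp : (∫ ω, h (∑ k, X k ω) ∂P) - ∫ x, h x ∂gaussianReal 0 1 =
      (1 - ∫ ω, (∑ k, X k ω) ^ 2 ∂P) * (∫ ω, g (∑ k, X k ω) ∂P)
        - ∑ k, ((∫ ω, X k ω * f (∑ j, X j ω) ∂P)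
          - (∫ ω, X k ω ^ 2 ∂P) * ∫ ω, g (∑ j, X j ω) ∂P) := by
    rw [hstein, integral_sum_sq hmeas hindep hX0 hX2, Finset.sum_sub_distrib, ← Finset.sum_mul]
    ring
  rw [hdecomp, add_assoc, ← Finset.sum_add_distrib]
  refine (abs_sub _ _).trans (add_le_add ?_ ?_)
  · rw [abs_mul]
    exact mul_le_of_le_one_right (abs_nonneg _) hg1
  · exact (Finset.abs_sum_le_sum_abs _ _).trans (Finset.sum_le_sum fun k _ ↦ hterm k)

end Sum

end GaussianStein

theorem sum_indep_wasserstein_bound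
    {Ω : Type*} [MeasureSpace Ω] [IsProbabilityMeasure (ℙ : Measure Ω)]
    (n : ℕ) (X : Fin n → Ω → ℝ)
    (hmeas : ∀ k, Measurable (X k))
    (hindep : iIndepFun X ℙ)
    (hint : ∀ k, Integrable (X k))
    (hcentered : ∀ k, ∫ ω, X k ω = 0)
    (hthird : ∀ k, Integrable (fun ω => |X k ω| ^ 3)) :
    dW (Measure.map (fun ω => ∑ k, X k ω) ℙ) stdGaussian ≤
      |1 - ∫ ω, (∑ k, X k ω) ^ 2| + (∑ k, ∫ ω, |X k ω| ^ 3) +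
        ∑ k, (∫ ω, |X k ω|) * ∫ ω, (X k ω) ^ 2 := by
  have : Nonempty {f : ℝ → ℝ // LipschitzWith 1 f} := ⟨⟨id, LipschitzWith.id⟩⟩
  refine ciSup_le fun h ↦ ?_
  rw [integral_map (by fun_prop) h.2.continuous.aestronglyMeasurable]
  exact GaussianStein.abs_integral_comp_sum_sub_le h.2 hmeas hindep hint hcentered hthird
end

section
/- Let X_1, …, X_n be independent real random variables with E[X_k] = 0 and E[|X_k|³] < ∞ for each k, let Z_n := X_1 + ⋯ + X_n and assume E[Z_n²] > 0. Then the normalized sum Z̃_n := Z_n / √(E[Z_n²]) satisfies d_W(Z̃_n, 𝒩) ≤ (2 / (E[Z_n²])^{3/2}) Σ_{k=1}^n E[|X_k|³]. -/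
open MeasureTheory ProbabilityTheory

open Filter Topology Set

lemma gaussianPDFReal_zero_one (x : ℝ) :
    gaussianPDFReal 0 1 x = (√(2 * Real.pi))⁻¹ * Real.exp (-x ^ 2 / 2) := by
  simp [gaussianPDFReal]

lemma hasDerivAt_gaussianPDFReal_zero_one (x : ℝ) :
    HasDerivAt (gaussianPDFReal 0 1) (-x * gaussianPDFReal 0 1 x) x := by
  rw [funext gaussianPDFReal_zero_one]
  have h : HasDerivAt (fun x : ℝ => -x ^ 2 / 2) (-x) x := by
    exact ((hasDerivAt_pow 2 x).neg.div_const 2).congr_deriv (by simp; ring)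
  exact (h.exp.const_mul (√(2 * Real.pi))⁻¹).congr_deriv (by ring)

lemma continuous_gaussianPDFReal_zero_one : Continuous (gaussianPDFReal 0 1) :=
  continuous_iff_continuousAt.2 fun x => (hasDerivAt_gaussianPDFReal_zero_one x).continuousAt

lemma tendsto_gaussianPDFReal_zero_one_cocompact :
    Tendsto (gaussianPDFReal 0 1) (cocompact ℝ) (𝓝 0) := by
  rw [funext gaussianPDFReal_zero_one]
  have h : Tendsto (fun x : ℝ => -x ^ 2 / 2) (cocompact ℝ) atBot := by
    have := (tendsto_pow_atTop (α := ℝ) two_ne_zero).comp (tendsto_norm_cocompact_atTop (E := ℝ))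
    have := (tendsto_neg_atTop_atBot.comp this).atBot_div_const (two_pos)
    simpa [Function.comp_def] using this
  simpa using (Real.tendsto_exp_atBot.comp h).const_mul (√(2 * Real.pi))⁻¹

/-- Integrability against the standard Gaussian law in terms of its density. -/
lemma integrable_mul_gaussianPDFReal_zero_one {g : ℝ → ℝ} (hg : Integrable g (gaussianReal 0 1)) :
    Integrable (fun x => g x * gaussianPDFReal 0 1 x) := by
  rw [gaussianReal_of_var_ne_zero _ one_ne_zero,
    integrable_withDensity_iff_integrable_smul' (measurable_gaussianPDF 0 1)
    (ae_of_all _ fun _ => gaussianPDF_lt_top)] at hg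
  simpa [mul_comm] using hg

lemma integral_mul_gaussianPDFReal_zero_one (g : ℝ → ℝ) :
    ∫ x, g x * gaussianPDFReal 0 1 x = ∫ x, g x ∂(gaussianReal 0 1) := by
  rw [integral_gaussianReal_eq_integral_smul one_ne_zero]
  simp [mul_comm]

/-- An explicit minorant of the upper Gaussian tail, up to sign. -/
noncomputable def millsPrimitive (x : ℝ) : ℝ := -(x / (1 + x ^ 2)) * gaussianPDFReal 0 1 x

lemma abs_div_one_add_sq_le (x : ℝ) : |x / (1 + x ^ 2)| ≤ 1 := by
  rw [abs_div, abs_of_pos (by positivity : 0 < 1 + x ^ 2), div_le_one (by positivity)]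
  nlinarith [sq_abs x, sq_nonneg (|x| - 1)]

lemma tendsto_millsPrimitive : Tendsto millsPrimitive (cocompact ℝ) (𝓝 0) := by
  refine squeeze_zero_norm (fun x => ?_) tendsto_gaussianPDFReal_zero_one_cocompact
  rw [millsPrimitive, norm_mul, norm_neg, Real.norm_eq_abs, Real.norm_eq_abs,
    abs_of_nonneg (gaussianPDFReal_nonneg 0 1 x)]
  exact mul_le_of_le_one_left (gaussianPDFReal_nonneg 0 1 x) (abs_div_one_add_sq_le x)

/-- The ratio of the derivative of `millsPrimitive` to the Gaussian density. -/
noncomputable def millsFactor (x : ℝ) : ℝ := 1 - 2 / (1 + x ^ 2) ^ 2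

lemma hasDerivAt_millsPrimitive (x : ℝ) :
    HasDerivAt millsPrimitive (millsFactor x * gaussianPDFReal 0 1 x) x := by
  have hx : (1 + x ^ 2) ≠ 0 := by positivity
  have h : HasDerivAt (fun x : ℝ => 1 + x ^ 2) (2 * x) x := by
    simpa using (hasDerivAt_pow 2 x).const_add 1
  refine (((hasDerivAt_id x).div h hx).neg.mul
    (hasDerivAt_gaussianPDFReal_zero_one x)).congr_deriv ?_
  simp only [millsFactor, id, Pi.neg_apply, Pi.div_apply]
  field_simp
  ring

lemma integrable_millsFactor_mul :
    Integrable (fun x => millsFactor x * gaussianPDFReal 0 1 x) := by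
  refine (integrable_gaussianPDFReal 0 1).bdd_mul (c := 1) ?_ (ae_of_all _ fun x => ?_)
  · refine Continuous.aestronglyMeasurable ?_
    unfold millsFactor
    exact continuous_const.sub (continuous_const.div₀ (by fun_prop) fun x => by positivity)
  · have h1 : 0 < 2 / (1 + x ^ 2) ^ 2 := by positivity
    have h2 : 2 / (1 + x ^ 2) ^ 2 ≤ 2 := by
      rw [div_le_iff₀ (by positivity)]
      nlinarith [sq_nonneg x, sq_nonneg (x ^ 2)]
    rw [Real.norm_eq_abs, abs_le, millsFactor]
    constructor <;> linarith

lemma millsFactor_mul_le (x : ℝ) :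
    millsFactor x * gaussianPDFReal 0 1 x ≤ gaussianPDFReal 0 1 x := by
  refine mul_le_of_le_one_left (gaussianPDFReal_nonneg 0 1 x) ?_
  have h1 : 0 < 2 / (1 + x ^ 2) ^ 2 := by positivity
  rw [millsFactor]
  linarith

/-- The lower Mills ratio bound for the upper Gaussian tail. -/
lemma mul_gaussianPDFReal_le_integral_Ioi (x : ℝ) :
    x * gaussianPDFReal 0 1 x ≤ (1 + x ^ 2) * ∫ t in Ioi x, gaussianPDFReal 0 1 t := by
  have h := integral_Ioi_of_hasDerivAt_of_tendsto'
    (fun y _ => hasDerivAt_millsPrimitive y) (integrable_millsFactor_mul.integrableOn (s := Ioi x))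
    (tendsto_millsPrimitive.mono_left atTop_le_cocompact)
  have h2 := setIntegral_mono (s := Ioi x) integrable_millsFactor_mul.integrableOn
    (integrable_gaussianPDFReal 0 1).integrableOn millsFactor_mul_le
  rw [h, millsPrimitive] at h2
  have h3 := mul_le_mul_of_nonneg_left h2 (by positivity : 0 ≤ 1 + x ^ 2)
  refine le_of_eq_of_le ?_ h3
  field_simp
  ring

/-- The lower Mills ratio bound for the lower Gaussian tail. -/
lemma neg_mul_gaussianPDFReal_le_integral_Iic (x : ℝ) :
    -x * gaussianPDFReal 0 1 x ≤ (1 + x ^ 2) * ∫ t in Iic x, gaussianPDFReal 0 1 t := by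
  have h := integral_Iic_of_hasDerivAt_of_tendsto'
    (fun y _ => hasDerivAt_millsPrimitive y) (integrable_millsFactor_mul.integrableOn (s := Iic x))
    (tendsto_millsPrimitive.mono_left atBot_le_cocompact)
  have h2 := setIntegral_mono (s := Iic x) integrable_millsFactor_mul.integrableOn
    (integrable_gaussianPDFReal 0 1).integrableOn millsFactor_mul_le
  rw [h, millsPrimitive] at h2
  have h3 := mul_le_mul_of_nonneg_left h2 (by positivity : 0 ≤ 1 + x ^ 2)
  refine le_of_eq_of_le ?_ h3
  field_simp
  ring

/-- For a nondecreasing centered test function, the Stein solution `f` satisfies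
that `x * f x` has nonpositive derivative; stated after multiplication by the Gaussian density. -/
lemma stein_monotone_bound {k : ℝ → ℝ} (hk : Monotone k)
    (hki : Integrable k (gaussianReal 0 1)) (hk0 : ∫ x, k x ∂(gaussianReal 0 1) = 0) (x : ℝ) :
    (1 + x ^ 2) * (∫ t in Iic x, k t * gaussianPDFReal 0 1 t)
      + x * k x * gaussianPDFReal 0 1 x ≤ 0 := by
  have hi := integrable_mul_gaussianPDFReal_zero_one hki
  have hp := integrable_gaussianPDFReal 0 1
  have hx : 0 ≤ 1 + x ^ 2 := by positivity
  have hsum := intervalIntegral.integral_Iic_add_Ioi (b := x) hi.integrableOn hi.integrableOn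
  rw [integral_mul_gaussianPDFReal_zero_one, hk0] at hsum
  rcases le_total 0 (k x) with h0 | h0
  · have h1 : k x * ∫ t in Ioi x, gaussianPDFReal 0 1 t
        ≤ ∫ t in Ioi x, k t * gaussianPDFReal 0 1 t := by
      rw [← integral_const_mul]
      exact setIntegral_mono_on (hp.const_mul _).integrableOn hi.integrableOn measurableSet_Ioi
        fun t ht => mul_le_mul_of_nonneg_right (hk (le_of_lt ht)) (gaussianPDFReal_nonneg 0 1 t)
    have h2 := mul_le_mul_of_nonneg_left (mul_gaussianPDFReal_le_integral_Ioi x) h0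
    have h3 := mul_le_mul_of_nonneg_left h1 hx
    rw [eq_neg_of_add_eq_zero_left hsum]
    linarith
  · have h1 : ∫ t in Iic x, k t * gaussianPDFReal 0 1 t
        ≤ k x * ∫ t in Iic x, gaussianPDFReal 0 1 t := by
      rw [← integral_const_mul]
      exact setIntegral_mono_on hi.integrableOn (hp.const_mul _).integrableOn measurableSet_Iic
        fun t ht => mul_le_mul_of_nonneg_right (hk ht) (gaussianPDFReal_nonneg 0 1 t)
    have h2 := mul_le_mul_of_nonpos_left (neg_mul_gaussianPDFReal_le_integral_Iic x) h0
    have h3 := mul_le_mul_of_nonneg_left h1 hx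
    linarith

lemma integral_Iic_id_mul_gaussianPDFReal (x : ℝ) :
    ∫ t in Iic x, t * gaussianPDFReal 0 1 t = -gaussianPDFReal 0 1 x := by
  have hi : Integrable (fun t => t * gaussianPDFReal 0 1 t) :=
    integrable_mul_gaussianPDFReal_zero_one ((memLp_id_gaussianReal 1).integrable le_rfl)
  have h := integral_Iic_of_hasDerivAt_of_tendsto' (a := x)
    (fun y _ => hasDerivAt_gaussianPDFReal_zero_one y)
    (by simpa using hi.neg.integrableOn (s := Iic x))
    (tendsto_gaussianPDFReal_zero_one_cocompact.mono_left atBot_le_cocompact)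
  simp only [neg_mul, integral_neg, sub_zero] at h
  linarith

lemma LipschitzWith.integrable_of_integrable_id {μ : Measure ℝ} [IsFiniteMeasure μ]
    {K : NNReal} {h : ℝ → ℝ} (hh : LipschitzWith K h) (hμ : Integrable (fun x => x) μ) :
    Integrable h μ := by
  refine Integrable.mono' ((integrable_const |h 0|).add (hμ.abs.const_mul K))
    hh.continuous.aestronglyMeasurable (ae_of_all _ fun x => ?_)
  have h1 := hh.dist_le_mul x 0
  rw [Real.dist_eq, Real.dist_eq, sub_zero] at h1
  have h2 := abs_sub_abs_le_abs_sub (h x) (h 0)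
  simp only [Pi.add_apply, Real.norm_eq_abs]
  linarith

/-- The Stein equation for a 1-Lipschitz test function has a solution `f` bounded by `1` with
`x ↦ x * f x` also 1-Lipschitz. -/
lemma exists_stein_solution {h : ℝ → ℝ} (hh : LipschitzWith 1 h) :
    ∃ f : ℝ → ℝ, (∀ x, HasDerivAt f (x * f x + h x - ∫ t, h t ∂(gaussianReal 0 1)) x) ∧
      (∀ x, |f x| ≤ 1) ∧ LipschitzWith 1 (fun x => x * f x) := by
  set c := ∫ t, h t ∂(gaussianReal 0 1) with hc
  set p := gaussianPDFReal 0 1 with hp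
  have hid : Integrable (fun x : ℝ => x) (gaussianReal 0 1) :=
    (memLp_id_gaussianReal 1).integrable le_rfl
  have hhi := hh.integrable_of_integrable_id hid
  have hki : Integrable (fun x => h x - c) (gaussianReal 0 1) := hhi.sub (integrable_const c)
  have hk0 : ∫ x, (h x - c) ∂(gaussianReal 0 1) = 0 := by
    rw [integral_sub hhi (integrable_const c)]
    simp [hc]
  have hi := integrable_mul_gaussianPDFReal_zero_one hki
  have hidp := integrable_mul_gaussianPDFReal_zero_one hid
  have hcont : Continuous fun x => (h x - c) * p x :=
    (hh.continuous.sub continuous_const).mul continuous_gaussianPDFReal_zero_one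
  set F : ℝ → ℝ := fun x => ∫ t in Iic x, (h t - c) * p t with hF
  have hpos : ∀ x, 0 < p x := fun x => gaussianPDFReal_pos 0 1 x one_ne_zero
  have hFd : ∀ x, HasDerivAt F ((h x - c) * p x) x := by
    intro x
    have h1 : F = fun y => F 0 + ∫ t in (0:ℝ)..y, (h t - c) * p t := by
      ext y
      rw [← intervalIntegral.integral_Iic_sub_Iic hi.integrableOn hi.integrableOn]
      simp only [hF, hp]
      ring
    rw [h1]
    exact (hcont.integral_hasStrictDerivAt 0 x).hasDerivAt.const_add _
  have hd : ∀ x, HasDerivAt (fun x => F x / p x) (x * (F x / p x) + h x - c) x := by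
    intro x
    refine ((hFd x).div (hasDerivAt_gaussianPDFReal_zero_one x) (hpos x).ne').congr_deriv ?_
    have := (hpos x).ne'
    simp only [← hp]
    field_simp
    ring
  have hlip : ∀ x y, x ≤ y → |h y - h x| ≤ y - x := fun x y hxy => by
    simpa [Real.dist_eq, abs_of_nonneg (sub_nonneg.2 hxy)] using hh.dist_le_mul y x
  have hbound : ∀ x, |F x / p x + x * (x * (F x / p x) + h x - c)| ≤ 1 := by
    intro x
    have h1 := stein_monotone_bound (k := fun x => x + (h x - c))
      (fun a b hab => by have := abs_le.1 (hlip a b hab); simp only; linarith)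
      (hid.add hki) (by rw [integral_add hid hki, hk0]; simp) x
    have h2 := stein_monotone_bound (k := fun x => x - (h x - c))
      (fun a b hab => by have := abs_le.1 (hlip a b hab); simp only; linarith)
      (hid.sub hki) (by rw [integral_sub hid hki, hk0]; simp) x
    have h4 : ∫ t in Iic x, (t + (h t - c)) * p t = -p x + F x := by
      simp only [add_mul _ (h _ - c)]
      rw [integral_add hidp.integrableOn hi.integrableOn, integral_Iic_id_mul_gaussianPDFReal]
    have h5 : ∫ t in Iic x, (t - (h t - c)) * p t = -p x - F x := by
      simp only [sub_mul _ (h _ - c)]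
      rw [integral_sub hidp.integrableOn hi.integrableOn, integral_Iic_id_mul_gaussianPDFReal]
    rw [← hp, h4] at h1
    rw [← hp, h5] at h2
    have h3 : F x / p x + x * (x * (F x / p x) + h x - c)
        = ((1 + x ^ 2) * F x + x * (h x - c) * p x) / p x := by
      have := (hpos x).ne'
      field_simp
      ring
    rw [h3, abs_div, abs_of_pos (hpos x), div_le_one (hpos x), abs_le]
    constructor <;> linarith
  have hxf : LipschitzWith 1 fun x => x * (F x / p x) := by
    refine lipschitzWith_of_nnnorm_deriv_le (𝕜 := ℝ)
      (fun x => ((hasDerivAt_id x).mul (hd x)).differentiableAt) fun x => ?_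
    have h1 : HasDerivAt (fun x => x * (F x / p x)) _ x := (hasDerivAt_id x).mul (hd x)
    rw [h1.deriv, ← NNReal.coe_le_coe, coe_nnnorm, Real.norm_eq_abs]
    simpa using hbound x
  refine ⟨fun x => F x / p x, hd, fun x => ?_, hxf⟩
  rcases eq_or_ne x 0 with rfl | hx
  · simpa using hbound 0
  · have h1 := hxf.dist_le_mul x 0
    simp only [Real.dist_eq, abs_mul, zero_mul, sub_zero, NNReal.coe_one, one_mul] at h1
    exact le_of_mul_le_mul_left (by simpa using h1) (abs_pos.2 hx)

/-- First-order Taylor bound for a function with Lipschitz derivative. -/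
lemma abs_taylor_one_le_of_lipschitz_deriv {φ ψ : ℝ → ℝ} {L : NNReal}
    (hφ : ∀ x, HasDerivAt φ (ψ x) x) (hψ : LipschitzWith L ψ) (a b : ℝ) :
    |φ (a + b) - φ a - b * ψ a| ≤ L * b ^ 2 / 2 := by
  have hg : ∀ t : ℝ, HasDerivAt (fun t => φ (a + t * b) - φ a - t * (b * ψ a))
      (b * (ψ (a + t * b) - ψ a)) t := by
    intro t
    have h1 : HasDerivAt (fun t : ℝ => a + t * b) b t := by
      simpa using ((hasDerivAt_id t).mul_const b).const_add a
    have h2 : HasDerivAt (fun t : ℝ => t * (b * ψ a)) (b * ψ a) t := by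
      simpa using (hasDerivAt_id t).mul_const (b * ψ a)
    have h3 : HasDerivAt (fun t => φ (a + t * b)) (ψ (a + t * b) * b) t :=
      (hφ (a + t * b)).comp t h1
    exact ((h3.sub_const _).sub h2).congr_deriv (by ring)
  have hB : ∀ t : ℝ, HasDerivAt (fun t : ℝ => L * b ^ 2 * (t ^ 2 / 2)) (L * b ^ 2 * t) t := fun t =>
    (((hasDerivAt_pow 2 t).div_const 2).const_mul ((L : ℝ) * b ^ 2)).congr_deriv (by simp)
  have h := image_norm_le_of_norm_deriv_right_le_deriv_boundary (a := 0) (b := 1)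
    (fun t _ => (hg t).continuousAt.continuousWithinAt) (fun t _ => (hg t).hasDerivWithinAt)
    (by simp) hB (fun t ht => ?_) (right_mem_Icc.2 zero_le_one)
  · simp only [one_mul, Real.norm_eq_abs] at h
    linarith
  · have h1 := hψ.dist_le_mul (a + t * b) a
    rw [Real.dist_eq, Real.dist_eq, add_sub_cancel_left, abs_mul, abs_of_nonneg ht.1] at h1
    rw [norm_mul, Real.norm_eq_abs, Real.norm_eq_abs]
    calc |b| * |ψ (a + t * b) - ψ a| ≤ |b| * (L * (t * |b|)) := by gcongr
      _ = L * b ^ 2 * t := by rw [← sq_abs b]; ring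

/-- A deterministic inequality whose expectation over independent copies compares
`E[X φ(X)]` with `E[X²] E[ψ(X)]`, where `ψ` is the derivative of `φ`. -/
lemma abs_symmetrized_stein_le {φ ψ : ℝ → ℝ} {L : NNReal}
    (hφ : ∀ x, HasDerivAt φ (ψ x) x) (hψ : LipschitzWith L ψ) (x y : ℝ) :
    |(x - y) * (φ x - φ y - x * ψ y + y * ψ x)| ≤ L * (|x| ^ 3 + |y| ^ 3) := by
  have h1 := abs_taylor_one_le_of_lipschitz_deriv hφ hψ x y
  have h2 := abs_taylor_one_le_of_lipschitz_deriv hφ hψ y x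
  rw [add_comm y x] at h2
  have h3 : |φ x - φ y - x * ψ y + y * ψ x| ≤ L * ((|x| ^ 2 + |y| ^ 2) / 2) := by
    rw [sq_abs, sq_abs]
    rw [abs_le] at *
    constructor <;> linarith
  have h4 : |x - y| ≤ |x| + |y| := abs_sub x y
  have h5 : (|x| + |y|) * ((|x| ^ 2 + |y| ^ 2) / 2) ≤ |x| ^ 3 + |y| ^ 3 := by
    nlinarith [mul_nonneg (add_nonneg (abs_nonneg x) (abs_nonneg y)) (sq_nonneg (|x| - |y|))]
  rw [abs_mul]
  calc |x - y| * |φ x - φ y - x * ψ y + y * ψ x|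
      ≤ (|x| + |y|) * (L * ((|x| ^ 2 + |y| ^ 2) / 2)) := by gcongr
    _ = L * ((|x| + |y|) * ((|x| ^ 2 + |y| ^ 2) / 2)) := by ring
    _ ≤ L * (|x| ^ 3 + |y| ^ 3) := by gcongr

lemma integrable_sq_of_integrable_abs_pow_three {α : Type*} [MeasurableSpace α] {μ : Measure α}
    [IsFiniteMeasure μ] {f : α → ℝ} (hf : AEStronglyMeasurable f μ)
    (h3 : Integrable (fun x => |f x| ^ 3) μ) : Integrable (fun x => f x ^ 2) μ := by
  refine ((integrable_const (1 : ℝ)).add h3).mono' (hf.pow 2) (ae_of_all _ fun x => ?_)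
  simp only [Pi.add_apply, Real.norm_eq_abs, abs_pow]
  have := abs_nonneg (f x)
  rcases le_total |f x| 1 with h | h
  · nlinarith [pow_nonneg this 3]
  · nlinarith [pow_nonneg this 2]

lemma abs_integral_id_mul_sub_le {μ : Measure ℝ} [IsProbabilityMeasure μ]
    (hi : Integrable (fun x => x) μ) (hmean : ∫ x, x ∂μ = 0)
    (h3 : Integrable (fun x => |x| ^ 3) μ) {φ ψ : ℝ → ℝ} {L : NNReal}
    (hφ : ∀ x, HasDerivAt φ (ψ x) x) (hψ : LipschitzWith L ψ) (hbdd : ∀ x, |φ x| ≤ 1) :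
    |∫ x, x * φ x ∂μ - (∫ x, x ^ 2 ∂μ) * ∫ x, ψ x ∂μ| ≤ L * ∫ x, |x| ^ 3 ∂μ := by
  have h2 : Integrable (fun x : ℝ => x ^ 2) μ :=
    integrable_sq_of_integrable_abs_pow_three aestronglyMeasurable_id h3
  have hφc : Continuous φ := continuous_iff_continuousAt.2 fun x => (hφ x).continuousAt
  have hφi : Integrable φ μ :=
    (integrable_const (1 : ℝ)).mono' hφc.aestronglyMeasurable (ae_of_all _ hbdd)
  have hxφ : Integrable (fun x => x * φ x) μ :=
    hi.mul_bdd (c := 1) hφc.aestronglyMeasurable (ae_of_all _ hbdd)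
  have hψi : Integrable ψ μ := hψ.integrable_of_integrable_id hi
  have hxψ : Integrable (fun x => x * ψ x) μ := by
    refine ((hi.abs.const_mul |ψ 0|).add (h2.const_mul L)).mono'
      (continuous_id.mul hψ.continuous).aestronglyMeasurable (ae_of_all _ fun x => ?_)
    have h1 := hψ.dist_le_mul x 0
    rw [Real.dist_eq, Real.dist_eq, sub_zero] at h1
    have h2 := abs_sub_abs_le_abs_sub (ψ x) (ψ 0)
    simp only [Pi.add_apply, Real.norm_eq_abs, abs_mul]
    rw [← sq_abs x]
    nlinarith [abs_nonneg x]
  have hc : Integrable (fun _ : ℝ => (1 : ℝ)) μ := integrable_const 1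
  have e1 := hxφ.mul_prod hc
  have e2 := hc.mul_prod hxφ
  have e3 := hi.mul_prod hφi
  have e4 := hφi.mul_prod hi
  have e5 := h2.mul_prod hψi
  have e6 := hψi.mul_prod h2
  have e7 := hxψ.mul_prod hi
  have e8 := hi.mul_prod hxψ
  have hT : ∫ z : ℝ × ℝ, (z.1 - z.2) * (φ z.1 - φ z.2 - z.1 * ψ z.2 + z.2 * ψ z.1) ∂(μ.prod μ)
      = 2 * (∫ x, x * φ x ∂μ - (∫ x, x ^ 2 ∂μ) * ∫ x, ψ x ∂μ) := by
    have : (fun z : ℝ × ℝ => (z.1 - z.2) * (φ z.1 - φ z.2 - z.1 * ψ z.2 + z.2 * ψ z.1))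
        = fun z => z.1 * φ z.1 * 1 + 1 * (z.2 * φ z.2) - z.1 * φ z.2 - φ z.1 * z.2
          - z.1 ^ 2 * ψ z.2 - ψ z.1 * z.2 ^ 2 + z.1 * ψ z.1 * z.2 + z.1 * (z.2 * ψ z.2) := by
      ext z
      ring
    rw [this, integral_add (by fun_prop) e8, integral_add (by fun_prop) e7,
      integral_sub (by fun_prop) e6, integral_sub (by fun_prop) e5,
      integral_sub (by fun_prop) e4, integral_sub (by fun_prop) e3, integral_add e1 e2,
      integral_prod_mul (fun x => x * φ x) (fun _ => (1 : ℝ)),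
      integral_prod_mul (fun _ => (1 : ℝ)) (fun x => x * φ x),
      integral_prod_mul (fun x => x) φ, integral_prod_mul φ (fun x => x),
      integral_prod_mul (fun x => x ^ 2) ψ, integral_prod_mul ψ (fun x => x ^ 2),
      integral_prod_mul (fun x => x * ψ x) (fun x => x),
      integral_prod_mul (fun x => x) (fun x => x * ψ x), hmean]
    simp
    ring
  have hB : ∫ z : ℝ × ℝ, L * (|z.1| ^ 3 * 1 + 1 * |z.2| ^ 3) ∂(μ.prod μ)
      = 2 * (L * ∫ x, |x| ^ 3 ∂μ) := by
    rw [integral_const_mul, integral_add (h3.mul_prod hc) (hc.mul_prod h3),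
      integral_prod_mul (fun x => |x| ^ 3) (fun _ => (1 : ℝ)),
      integral_prod_mul (fun _ => (1 : ℝ)) (fun x => |x| ^ 3)]
    simp
    ring
  have hle := norm_integral_le_of_norm_le
    (f := fun z : ℝ × ℝ => (z.1 - z.2) * (φ z.1 - φ z.2 - z.1 * ψ z.2 + z.2 * ψ z.1))
    (((h3.mul_prod hc).add (hc.mul_prod h3)).const_mul (L : ℝ))
    (ae_of_all (μ.prod μ) fun z : ℝ × ℝ => by
      simpa only [Pi.add_apply, mul_one, one_mul, Real.norm_eq_abs] using abs_symmetrized_stein_le hφ hψ z.1 z.2)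
  simp only [Pi.add_apply] at hle
  rw [hT, hB, Real.norm_eq_abs, abs_mul, abs_two] at hle
  linarith

/-- The local Stein bound: replacing `E[Y f(V + Y)]` by `E[Y²] E[g(V + Y)]`, with `g` the derivative of `f`, costs a third
moment of the centered variable `Y`, for `V` independent of `Y`. -/
lemma ProbabilityTheory.IndepFun.abs_integral_mul_sub_le {Ω : Type*} [MeasurableSpace Ω] {P : Measure Ω}
    [IsProbabilityMeasure P] {V Y : Ω → ℝ} (hVY : IndepFun V Y P) (hV : Measurable V)
    (hY : Measurable Y) (hVi : Integrable V P) (hYi : Integrable Y P) (hY0 : ∫ ω, Y ω ∂P = 0)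
    (hY3 : Integrable (fun ω => |Y ω| ^ 3) P) {f g : ℝ → ℝ} {L : NNReal}
    (hf : ∀ x, HasDerivAt f (g x) x) (hg : LipschitzWith L g) (hbdd : ∀ x, |f x| ≤ 1) :
    |∫ ω, Y ω * f (V ω + Y ω) ∂P - (∫ ω, Y ω ^ 2 ∂P) * ∫ ω, g (V ω + Y ω) ∂P|
      ≤ L * ∫ ω, |Y ω| ^ 3 ∂P := by
  have hfc : Continuous f := continuous_iff_continuousAt.2 fun x => (hf x).continuousAt
  have hgc : Continuous g := hg.continuous
  set ν := P.map V
  set μ := P.map Y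
  have : IsProbabilityMeasure ν := Measure.isProbabilityMeasure_map hV.aemeasurable
  have : IsProbabilityMeasure μ := Measure.isProbabilityMeasure_map hY.aemeasurable
  have hprod : P.map (fun ω => (V ω, Y ω)) = ν.prod μ :=
    (indepFun_iff_map_prod_eq_prod_map_map hV.aemeasurable hY.aemeasurable).1 hVY
  have hVYm : AEMeasurable (fun ω => (V ω, Y ω)) P := (hV.prodMk hY).aemeasurable
  have hc1 : Continuous fun z : ℝ × ℝ => z.2 * f (z.1 + z.2) := by fun_prop
  have hc2 : Continuous fun z : ℝ × ℝ => g (z.1 + z.2) := by fun_prop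
  have hi1 : Integrable (fun z : ℝ × ℝ => z.2 * f (z.1 + z.2)) (ν.prod μ) := by
    rw [← hprod, integrable_map_measure hc1.aestronglyMeasurable hVYm]
    exact hYi.mul_bdd (c := 1) (hfc.measurable.comp (hV.add hY)).aestronglyMeasurable
      (ae_of_all _ fun ω => hbdd _)
  have hi2 : Integrable (fun z : ℝ × ℝ => g (z.1 + z.2)) (ν.prod μ) := by
    rw [← hprod, integrable_map_measure hc2.aestronglyMeasurable hVYm]
    have hm : AEMeasurable (fun ω => V ω + Y ω) P := (hV.add hY).aemeasurable
    have : IsProbabilityMeasure (P.map fun ω => V ω + Y ω) := Measure.isProbabilityMeasure_map hm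
    have h := hg.integrable_of_integrable_id (μ := P.map fun ω => V ω + Y ω)
      ((integrable_map_measure continuous_id.aestronglyMeasurable hm).2 (hVi.add hYi))
    exact (integrable_map_measure hgc.aestronglyMeasurable hm).1 h
  have E1 : ∫ ω, Y ω * f (V ω + Y ω) ∂P = ∫ v, ∫ y, y * f (v + y) ∂μ ∂ν := by
    rw [← integral_prod _ hi1, ← hprod, integral_map hVYm hc1.aestronglyMeasurable]
  have E2 : ∫ ω, g (V ω + Y ω) ∂P = ∫ v, ∫ y, g (v + y) ∂μ ∂ν := by
    rw [← integral_prod _ hi2, ← hprod, integral_map hVYm hc2.aestronglyMeasurable]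
  have E3 : ∫ ω, Y ω ^ 2 ∂P = ∫ y, y ^ 2 ∂μ :=
    (integral_map hY.aemeasurable (continuous_pow 2).aestronglyMeasurable).symm
  have E4 : ∫ ω, |Y ω| ^ 3 ∂P = ∫ y, |y| ^ 3 ∂μ :=
    (integral_map hY.aemeasurable (continuous_abs.pow 3).aestronglyMeasurable).symm
  rw [E1, E2, E3, E4, ← integral_const_mul,
    ← integral_sub hi1.integral_prod_left (hi2.integral_prod_left.const_mul _)]
  suffices hv : ∀ v, |∫ y, y * f (v + y) ∂μ - (∫ y, y ^ 2 ∂μ) * ∫ y, g (v + y) ∂μ|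
      ≤ L * ∫ y, |y| ^ 3 ∂μ by
    simpa using norm_integral_le_of_norm_le_const (μ := ν)
      (f := fun v => ∫ y, y * f (v + y) ∂μ - (∫ y, y ^ 2 ∂μ) * ∫ y, g (v + y) ∂μ) (ae_of_all ν hv)
  intro v
  refine abs_integral_id_mul_sub_le
    ((integrable_map_measure continuous_id.aestronglyMeasurable hY.aemeasurable).2 hYi)
    ((integral_map hY.aemeasurable continuous_id.aestronglyMeasurable).trans hY0)
    ((integrable_map_measure (continuous_abs.pow 3).aestronglyMeasurable hY.aemeasurable).2 hY3)
    (fun x => (hf (v + x)).comp_const_add v x) ?_ fun x => hbdd _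
  simpa [Function.comp_def] using hg.comp (isometry_add_left v).lipschitz

/-- Wasserstein normal approximation of a sum of independent centered variables with unit total
variance, against a single test function. -/
lemma abs_integral_sum_sub_integral_gaussianReal_le {Ω ι : Type*} [MeasurableSpace Ω]
    {P : Measure Ω} [IsProbabilityMeasure P] [Fintype ι] {Y : ι → Ω → ℝ}
    (hmeas : ∀ k, Measurable (Y k)) (hindep : iIndepFun Y P) (hint : ∀ k, Integrable (Y k) P)
    (hcentered : ∀ k, ∫ ω, Y k ω ∂P = 0) (hthird : ∀ k, Integrable (fun ω => |Y k ω| ^ 3) P)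
    (hvar : ∑ k, ∫ ω, Y k ω ^ 2 ∂P = 1) {h : ℝ → ℝ} (hh : LipschitzWith 1 h) :
    |∫ ω, h (∑ k, Y k ω) ∂P - ∫ x, h x ∂(gaussianReal 0 1)|
      ≤ 2 * ∑ k, ∫ ω, |Y k ω| ^ 3 ∂P := by
  classical
  obtain ⟨f, hf, hbdd, hxf⟩ := exists_stein_solution hh
  set c := ∫ x, h x ∂(gaussianReal 0 1)
  obtain ⟨g, hgdef⟩ : ∃ g : ℝ → ℝ, ∀ x, g x = x * f x + h x - c := ⟨_, fun _ => rfl⟩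
  simp only [← hgdef] at hf
  have hg : LipschitzWith 2 g := by
    have h1 := (hxf.add hh).sub (LipschitzWith.const c)
    rw [add_zero, one_add_one_eq_two] at h1
    rwa [funext hgdef]
  have hfc : Continuous f := continuous_iff_continuousAt.2 fun x => (hf x).continuousAt
  set W : Ω → ℝ := fun ω => ∑ k, Y k ω with hW
  have hWm : Measurable W := Finset.measurable_fun_sum _ fun k _ => hmeas k
  have hWi : Integrable W P := integrable_finsetSum _ fun k _ => hint k
  have : IsProbabilityMeasure (P.map W) := Measure.isProbabilityMeasure_map hWm.aemeasurable
  have hlip : ∀ {K : NNReal} {u : ℝ → ℝ}, LipschitzWith K u → Integrable (fun ω => u (W ω)) P := by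
    intro K u hu
    refine (integrable_map_measure hu.continuous.aestronglyMeasurable hWm.aemeasurable).1 ?_
    exact hu.integrable_of_integrable_id
      ((integrable_map_measure continuous_id.aestronglyMeasurable hWm.aemeasurable).2 hWi)
  have hYf : ∀ k, Integrable (fun ω => Y k ω * f (W ω)) P := fun k =>
    (hint k).mul_bdd (c := 1) (hfc.measurable.comp hWm).aestronglyMeasurable
      (ae_of_all _ fun ω => hbdd _)
  have hlocal : ∀ k, |∫ ω, Y k ω * f (W ω) ∂P - (∫ ω, Y k ω ^ 2 ∂P) * ∫ ω, g (W ω) ∂P|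
      ≤ 2 * ∫ ω, |Y k ω| ^ 3 ∂P := by
    intro k
    have hsplit : ∀ ω, (∑ j ∈ Finset.univ.erase k, Y j) ω + Y k ω = W ω := fun ω => by
      rw [Finset.sum_apply, Finset.sum_erase_add _ _ (Finset.mem_univ k)]
    have h1 := (hindep.indepFun_finsetSum_of_notMem hmeas
      (Finset.notMem_erase k Finset.univ)).abs_integral_mul_sub_le (by fun_prop) (hmeas k)
      (integrable_finsetSum' _ fun j _ => hint j) (hint k) (hcentered k) (hthird k) hf hg hbdd
    simpa only [hsplit, NNReal.coe_ofNat] using h1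
  have hstein : ∫ ω, h (W ω) ∂P - c = ∫ ω, g (W ω) ∂P - ∫ ω, W ω * f (W ω) ∂P := by
    rw [← integral_sub (hlip hg) (hlip hxf)]
    have : ∀ ω, g (W ω) - W ω * f (W ω) = h (W ω) - c := fun ω => by rw [hgdef]; ring
    simp only [this]
    rw [integral_sub (hlip hh) (integrable_const c)]
    simp
  have hsum : ∫ ω, W ω * f (W ω) ∂P = ∑ k, ∫ ω, Y k ω * f (W ω) ∂P := by
    rw [← integral_finsetSum _ fun k _ => hYf k]
    simp only [hW, Finset.sum_mul]
  have hone : ∫ ω, g (W ω) ∂P = ∑ k, (∫ ω, Y k ω ^ 2 ∂P) * ∫ ω, g (W ω) ∂P := by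
    rw [← Finset.sum_mul, hvar, one_mul]
  rw [hstein, abs_sub_comm, hsum, hone, ← Finset.sum_sub_distrib, Finset.mul_sum]
  exact (Finset.abs_sum_le_sum_abs _ _).trans (Finset.sum_le_sum fun k _ => hlocal k)

theorem normalized_sum_wasserstein_third_moment_bound
    {Ω : Type*} [MeasureSpace Ω] [IsProbabilityMeasure (ℙ : Measure Ω)]
    (n : ℕ) (X : Fin n → Ω → ℝ)
    (hmeas : ∀ k, Measurable (X k))
    (hindep : iIndepFun X ℙ)
    (hint : ∀ k, Integrable (X k))
    (hcentered : ∀ k, ∫ ω, X k ω = 0)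
    (hthird : ∀ k, Integrable (fun ω => |X k ω| ^ 3))
    (hvarpos : 0 < ∫ ω, (∑ k, X k ω) ^ 2) :
    dW (Measure.map
        (fun ω => (∑ k, X k ω) / Real.sqrt (∫ ω', (∑ k, X k ω') ^ 2)) ℙ)
      stdGaussian ≤
      2 / (∫ ω, (∑ k, X k ω) ^ 2) ^ ((3 : ℝ) / 2) * ∑ k, ∫ ω, |X k ω| ^ 3 := by
  have hmem : ∀ k, MemLp (X k) 2 ℙ := fun k =>
    (memLp_two_iff_integrable_sq (hmeas k).aestronglyMeasurable).2
      (integrable_sq_of_integrable_abs_pow_three (hmeas k).aestronglyMeasurable (hthird k))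
  have hvar : ∫ ω, (∑ k, X k ω) ^ 2 = ∑ k, ∫ ω, X k ω ^ 2 := by
    have h1 := IndepFun.variance_sum (s := Finset.univ) (fun k _ => hmem k)
      (fun i _ j _ hij => hindep.indepFun hij)
    rw [variance_of_integral_eq_zero (by fun_prop)] at h1
    · simpa [variance_of_integral_eq_zero (hmeas _).aemeasurable (hcentered _)] using h1
    · simp only [Finset.sum_apply]
      rw [integral_finsetSum _ fun k _ => hint k]
      simp [hcentered]
  set V := ∫ ω, (∑ k, X k ω) ^ 2
  have hs : 0 < √V := Real.sqrt_pos.2 hvarpos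
  have hpow : V ^ ((3 : ℝ) / 2) = √V ^ 3 := by
    rw [Real.sqrt_eq_rpow, ← Real.rpow_natCast, ← Real.rpow_mul hvarpos.le]
    norm_num
  have hsq : ∑ k, ∫ ω, (X k ω / √V) ^ 2 = 1 := by
    simp only [div_pow, Real.sq_sqrt hvarpos.le, integral_div]
    rw [← Finset.sum_div, ← hvar, div_self hvarpos.ne']
  have habs : ∀ k ω, |X k ω / √V| ^ 3 = |X k ω| ^ 3 / √V ^ 3 := fun k ω => by
    rw [abs_div, abs_of_pos hs, div_pow]
  rw [dW, _root_.stdGaussian]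
  have : Nonempty {f : ℝ → ℝ // LipschitzWith 1 f} := ⟨⟨id, LipschitzWith.id⟩⟩
  refine ciSup_le fun ⟨h, hh⟩ => ?_
  have hbound := abs_integral_sum_sub_integral_gaussianReal_le
    (fun k => (hmeas k).div_const √V)
    (hindep.comp (fun _ x => x / √V) fun _ => measurable_id.div_const _)
    (fun k => (hint k).div_const _) (fun k => by rw [integral_div, hcentered, zero_div])
    (fun k => by simpa only [habs] using (hthird k).div_const (√V ^ 3)) hsq hh
  rw [integral_map ((Finset.measurable_fun_sum _ fun k _ => hmeas k).div_const _).aemeasurable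
    hh.continuous.aestronglyMeasurable]
  simp only [Finset.sum_div, habs, integral_div] at hbound ⊢
  refine hbound.trans_eq ?_
  rw [hpow, ← Finset.sum_div]
  ring
end
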